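/- Let s, t be real numbers with |t − s| > 1, and let α = min{s, t}. Then the function −Δ_{s,t}(x), where Δ_{s,t}(x) = [(ψ(x+t) − ψ(x+s))/(t − s)]² + (ψ'(x+t) − ψ'(x+s))/(t − s), is completely monotonic on the interval (−α, ∞). -/

import Mathlib

/-- The digamma function `ψ = Γ'/Γ`, as the derivative of `log ∘ Γ`. -/
noncomputable def digamma (x : ℝ) : ℝ := deriv (fun y : ℝ => Real.log (Real.Gamma y)) x

/-- The trigamma function `ψ'`. -/
noncomputable def trigamma (x : ℝ) : ℝ := deriv digamma x

open Set Filter Topology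
open scoped ContDiff

/-- The first `n` alternating finite differences of `f` are nonnegative on `(0, ∞)`. -/
def AlternatingDiff : ℕ → (ℝ → ℝ) → Prop
  | 0, f => ∀ x > 0, 0 ≤ f x
  | n + 1, f => (∀ x > 0, 0 ≤ f x) ∧ ∀ h > 0, AlternatingDiff n (fun x => f x - f (x + h))

namespace AlternatingDiff

theorem nonneg {n : ℕ} {f : ℝ → ℝ} (hf : AlternatingDiff n f) {x : ℝ} (hx : 0 < x) :
    0 ≤ f x := by
  cases n with
  | zero => exact hf x hx
  | succ n => exact hf.1 x hx

theorem of_succ {n : ℕ} {f : ℝ → ℝ} (hf : AlternatingDiff (n + 1) f) : AlternatingDiff n f := by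
  induction n generalizing f with
  | zero => exact hf.1
  | succ n ih => exact ⟨hf.1, fun h hh => ih (hf.2 h hh)⟩

theorem of_tendsto {n : ℕ} {u : ℕ → ℝ → ℝ} {f : ℝ → ℝ} (hu : ∀ k, AlternatingDiff n (u k))
    (hlim : ∀ x > 0, Tendsto (fun k => u k x) atTop (𝓝 (f x))) : AlternatingDiff n f := by
  have hnonneg : ∀ x > 0, 0 ≤ f x := fun x hx =>
    ge_of_tendsto' (hlim x hx) fun k => (hu k).nonneg hx
  induction n generalizing u f with
  | zero => exact hnonneg
  | succ n ih =>
    refine ⟨hnonneg, fun h hh => ?_⟩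
    have hlim' : ∀ x > 0, Tendsto (fun k => u k x - u k (x + h)) atTop (𝓝 (f x - f (x + h))) :=
      fun x hx => (hlim x hx).sub (hlim (x + h) (by linarith))
    exact ih (fun k => (hu k).2 h hh) hlim' fun x hx =>
      ge_of_tendsto' (hlim' x hx) fun k => ((hu k).2 h hh).nonneg hx

theorem congr {n : ℕ} {f g : ℝ → ℝ} (hf : AlternatingDiff n f) (h : ∀ x > 0, f x = g x) :
    AlternatingDiff n g :=
  of_tendsto (u := fun _ => f) (fun _ => hf) fun x hx => by
    rw [h x hx]; exact tendsto_const_nhds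

theorem zero (n : ℕ) : AlternatingDiff n fun _ => 0 := by
  induction n with
  | zero => exact fun _ _ => le_rfl
  | succ n ih => exact ⟨fun _ _ => le_rfl, fun _ _ => by simpa using ih⟩

theorem add {n : ℕ} {f g : ℝ → ℝ} (hf : AlternatingDiff n f) (hg : AlternatingDiff n g) :
    AlternatingDiff n fun x => f x + g x := by
  induction n generalizing f g with
  | zero => exact fun x hx => add_nonneg (hf x hx) (hg x hx)
  | succ n ih =>
    refine ⟨fun x hx => add_nonneg (hf.1 x hx) (hg.1 x hx), fun h hh => ?_⟩
    exact (ih (hf.2 h hh) (hg.2 h hh)).congr fun x _ => by ring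

theorem const_mul {n : ℕ} {f : ℝ → ℝ} {c : ℝ} (hc : 0 ≤ c) (hf : AlternatingDiff n f) :
    AlternatingDiff n fun x => c * f x := by
  induction n generalizing f with
  | zero => exact fun x hx => mul_nonneg hc (hf x hx)
  | succ n ih =>
    refine ⟨fun x hx => mul_nonneg hc (hf.1 x hx), fun h hh => ?_⟩
    exact (ih (hf.2 h hh)).congr fun x _ => by ring

theorem comp_add_const {n : ℕ} {f : ℝ → ℝ} {c : ℝ} (hc : 0 ≤ c) (hf : AlternatingDiff n f) :
    AlternatingDiff n fun x => f (x + c) := by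
  induction n generalizing f with
  | zero => exact fun x hx => hf _ (by linarith)
  | succ n ih =>
    refine ⟨fun x hx => hf.1 _ (by linarith), fun h hh => ?_⟩
    exact (ih (hf.2 h hh)).congr fun x _ => by rw [add_right_comm]

theorem mul {n : ℕ} {f g : ℝ → ℝ} (hf : AlternatingDiff n f) (hg : AlternatingDiff n g) :
    AlternatingDiff n fun x => f x * g x := by
  induction n generalizing f g with
  | zero => exact fun x hx => mul_nonneg (hf x hx) (hg x hx)
  | succ n ih =>
    refine ⟨fun x hx => mul_nonneg (hf.1 x hx) (hg.1 x hx), fun h hh => ?_⟩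
    exact ((ih (hf.2 h hh) hg.of_succ).add
      (ih (hf.of_succ.comp_add_const hh.le) (hg.2 h hh))).congr fun x _ => by ring

theorem inv_add_const (n : ℕ) {c : ℝ} (hc : 0 ≤ c) : AlternatingDiff n fun x => (x + c)⁻¹ := by
  have hnonneg : ∀ x : ℝ, x > 0 → 0 ≤ (x + c)⁻¹ := fun x hx => by positivity
  induction n with
  | zero => exact hnonneg
  | succ n ih =>
    refine ⟨hnonneg, fun h hh => ?_⟩
    refine ((ih.mul (ih.comp_add_const hh.le)).const_mul hh.le).congr fun x hx => ?_
    have : x + c ≠ 0 := by positivity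
    have : x + h + c ≠ 0 := by positivity
    field_simp
    ring

theorem of_sub_comp_add_one {n : ℕ} {f : ℝ → ℝ}
    (hf : AlternatingDiff n fun x => f x - f (x + 1)) (hlim : Tendsto f atTop (𝓝 0)) :
    AlternatingDiff n f := by
  have hsum : ∀ N : ℕ, AlternatingDiff n fun x => f x - f (x + N) := by
    intro N
    induction N with
    | zero => simpa using zero n
    | succ N ih =>
      exact (ih.add (hf.comp_add_const N.cast_nonneg)).congr fun x _ => by
        push_cast; rw [add_assoc x]; ring
  refine of_tendsto hsum fun x _ => ?_
  simpa using tendsto_const_nhds.sub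
    (hlim.comp (tendsto_atTop_add_const_left atTop x tendsto_natCast_atTop_atTop))

theorem neg_deriv {n : ℕ} {f f' : ℝ → ℝ} (hf : AlternatingDiff (n + 1) f)
    (hd : ∀ x > 0, HasDerivAt f (f' x) x) : AlternatingDiff n fun x => -f' x := by
  have hpos (k : ℕ) : (0 : ℝ) < 1 / ((k : ℝ) + 1) := by positivity
  refine of_tendsto (fun k : ℕ => (hf.2 _ (hpos k)).const_mul (inv_nonneg.2 (hpos k).le))
    fun x hx => ?_
  have hh : Tendsto (fun k : ℕ => 1 / ((k : ℝ) + 1)) atTop (𝓝[≠] 0) :=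
    tendsto_nhdsWithin_iff.2
      ⟨tendsto_one_div_add_atTop_nhds_zero_nat, Eventually.of_forall fun k => (hpos k).ne'⟩
  refine (((hasDerivAt_iff_tendsto_slope_zero.1 (hd x hx)).comp hh).neg).congr fun k => ?_
  simp only [Function.comp_apply, smul_eq_mul]
  ring

theorem iteratedDeriv_nonneg {n : ℕ} {f : ℝ → ℝ} (hf : AlternatingDiff n f)
    (hd : ContDiffOn ℝ ∞ f (Ioi 0)) {x : ℝ} (hx : 0 < x) :
    0 ≤ (-1 : ℝ) ^ n * iteratedDeriv n f x := by
  induction n generalizing f with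
  | zero => simpa using hf x hx
  | succ n ih =>
    have hd' : ContDiffOn ℝ ∞ (deriv f) (Ioi 0) := hd.deriv_of_isOpen isOpen_Ioi (by simp)
    have hderiv : ∀ y > 0, HasDerivAt f (deriv f y) y := fun y hy =>
      ((hd.contDiffAt (Ioi_mem_nhds hy)).differentiableAt (by simp)).hasDerivAt
    have := ih (hf.neg_deriv hderiv) hd'.neg
    rw [iteratedDeriv_fun_neg] at this
    rw [iteratedDeriv_succ', pow_succ]
    linarith

/-- A convex decreasing function that tends to `0` has derivative tending to `0`. -/
theorem tendsto_deriv_zero {f f' : ℝ → ℝ} (hf : AlternatingDiff 2 f)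
    (hd : ∀ x > 0, HasDerivAt f (f' x) x) (hlim : Tendsto f atTop (𝓝 0)) :
    Tendsto f' atTop (𝓝 0) := by
  have hf' := hf.neg_deriv hd
  have hshift : Tendsto (fun x : ℝ => f (x + -1) - f x) atTop (𝓝 0) := by
    simpa using (hlim.comp (tendsto_atTop_add_const_right atTop (-1) tendsto_id)).sub hlim
  have hneg : Tendsto (fun x => -f' x) atTop (𝓝 0) := by
    refine squeeze_zero' ?_ ?_ hshift
    · filter_upwards [eventually_gt_atTop 0] with x hx using hf'.nonneg hx
    · filter_upwards [eventually_gt_atTop 1] with x hx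
      obtain ⟨c, hc, hslope⟩ := exists_hasDerivAt_eq_slope f f' (by linarith : x + -1 < x)
        (fun y hy => (hd y (by linarith [hy.1])).continuousAt.continuousWithinAt)
        fun y hy => hd y (by linarith [hy.1])
      have hle := hf'.2 (x - c) (by linarith [hc.2]) c (by linarith [hc.1])
      have : x - (x + -1) = 1 := by ring
      rw [this, div_one] at hslope
      simp only [add_sub_cancel] at hle
      linarith
  simpa using hneg.neg

end AlternatingDiff

theorem contDiffOn_log_Gamma :
    ContDiffOn ℝ ∞ (fun y : ℝ => Real.log (Real.Gamma y)) (Ioi 0) := by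
  have hGamma : ContDiffOn ℝ ∞ Real.Gamma (Ioi 0) := by
    intro x hx
    have hdiff : DifferentiableOn ℂ Complex.Gamma {z | 0 < z.re} := fun z hz =>
      (Complex.differentiableAt_Gamma z fun m hm => by
        have : (0 : ℝ) < -m := by simpa [hm] using hz
        linarith [(Nat.cast_nonneg m : (0 : ℝ) ≤ m)]).differentiableWithinAt
    have hopen : IsOpen {z : ℂ | 0 < z.re} := isOpen_lt continuous_const Complex.continuous_re
    have hcont : ContDiffAt ℂ ∞ Complex.Gamma x :=
      (hdiff.contDiffOn hopen).contDiffAt (hopen.mem_nhds (by simpa using hx))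
    exact hcont.real_of_complex.contDiffWithinAt
  exact hGamma.log fun x hx => (Real.Gamma_pos_of_pos hx).ne'

theorem contDiffOn_digamma : ContDiffOn ℝ ∞ digamma (Ioi 0) :=
  contDiffOn_log_Gamma.deriv_of_isOpen isOpen_Ioi (by simp)

theorem contDiffOn_trigamma : ContDiffOn ℝ ∞ trigamma (Ioi 0) :=
  contDiffOn_digamma.deriv_of_isOpen isOpen_Ioi (by simp)

theorem hasDerivAt_log_Gamma {x : ℝ} (hx : 0 < x) :
    HasDerivAt (fun y : ℝ => Real.log (Real.Gamma y)) (digamma x) x :=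
  ((contDiffOn_log_Gamma.contDiffAt (Ioi_mem_nhds hx)).differentiableAt (by simp)).hasDerivAt

theorem hasDerivAt_digamma {x : ℝ} (hx : 0 < x) : HasDerivAt digamma (trigamma x) x :=
  ((contDiffOn_digamma.contDiffAt (Ioi_mem_nhds hx)).differentiableAt (by simp)).hasDerivAt

theorem monotoneOn_digamma : MonotoneOn digamma (Ioi 0) :=
  Real.convexOn_log_Gamma.monotoneOn_deriv fun _ hx => (hasDerivAt_log_Gamma hx).differentiableAt

theorem digamma_add_one {x : ℝ} (hx : 0 < x) : digamma (x + 1) = digamma x + x⁻¹ := by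
  have h1 := (hasDerivAt_log_Gamma (by linarith : 0 < x + 1)).comp_add_const x 1
  have h2 := (hasDerivAt_log_Gamma hx).add (Real.hasDerivAt_log hx.ne')
  refine h1.unique (h2.congr_of_eventuallyEq ?_)
  filter_upwards [Ioi_mem_nhds hx] with y hy
  have hy : 0 < y := hy
  rw [Real.Gamma_add_one hy.ne', Real.log_mul hy.ne' (Real.Gamma_pos_of_pos hy).ne']
  exact add_comm _ _

theorem trigamma_add_one {x : ℝ} (hx : 0 < x) : trigamma (x + 1) = trigamma x - (x ^ 2)⁻¹ := by
  have h1 := (hasDerivAt_digamma (by linarith : 0 < x + 1)).comp_add_const x 1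
  have h2 := (hasDerivAt_digamma hx).add (hasDerivAt_inv hx.ne')
  rw [sub_eq_add_neg]
  refine h1.unique (h2.congr_of_eventuallyEq ?_)
  filter_upwards [Ioi_mem_nhds hx] with y hy using digamma_add_one hy

/-- The difference quotient of the digamma function with step `d`. -/
noncomputable def digammaSlope (d x : ℝ) : ℝ := (digamma (x + d) - digamma x) / d

/-- The difference quotient of the trigamma function with step `d`. -/
noncomputable def trigammaSlope (d x : ℝ) : ℝ := (trigamma (x + d) - trigamma x) / d

theorem hasDerivAt_digammaSlope {d x : ℝ} (hd : 0 < d) (hx : 0 < x) :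
    HasDerivAt (digammaSlope d) (trigammaSlope d x) x :=
  (((hasDerivAt_digamma (by linarith : 0 < x + d)).comp_add_const x d).sub
    (hasDerivAt_digamma hx)).div_const d

theorem digammaSlope_sub_add_one {d x : ℝ} (hd : 0 < d) (hx : 0 < x) :
    digammaSlope d x - digammaSlope d (x + 1) = x⁻¹ * (x + d)⁻¹ := by
  have hxd : 0 < x + d := by linarith
  simp only [digammaSlope]
  rw [add_right_comm, digamma_add_one hx, digamma_add_one hxd]
  field_simp
  ring

theorem trigammaSlope_sub_add_one {d x : ℝ} (hd : 0 < d) (hx : 0 < x) :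
    trigammaSlope d x - trigammaSlope d (x + 1) = -((2 * x + d) * (x⁻¹ * (x + d)⁻¹) ^ 2) := by
  have hxd : 0 < x + d := by linarith
  simp only [trigammaSlope]
  rw [add_right_comm, trigamma_add_one hx, trigamma_add_one hxd]
  field_simp
  ring

theorem tendsto_digamma_add_natCast_sub (N : ℕ) :
    Tendsto (fun x : ℝ => digamma (x + N) - digamma x) atTop (𝓝 0) := by
  induction N with
  | zero => simp
  | succ N ih =>
    have hinv : Tendsto (fun x : ℝ => (x + N)⁻¹) atTop (𝓝 0) :=
      tendsto_inv_atTop_zero.comp (tendsto_atTop_add_const_right atTop (N : ℝ) tendsto_id)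
    have hsum := ih.add hinv
    rw [add_zero] at hsum
    refine hsum.congr' ?_
    filter_upwards [eventually_gt_atTop 0] with x hx
    have hxN : 0 < x + N := by positivity
    rw [Nat.cast_succ, ← add_assoc, digamma_add_one hxN]
    ring

theorem tendsto_digammaSlope {d : ℝ} (hd : 0 < d) : Tendsto (digammaSlope d) atTop (𝓝 0) := by
  obtain ⟨N, hN⟩ := exists_nat_ge d
  have hdiff : Tendsto (fun x => digamma (x + d) - digamma x) atTop (𝓝 0) := by
    refine squeeze_zero' ?_ ?_ (tendsto_digamma_add_natCast_sub N)
    · filter_upwards [eventually_gt_atTop 0] with x hx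
      exact sub_nonneg.2 (monotoneOn_digamma hx (by simp; linarith) (by linarith))
    · filter_upwards [eventually_gt_atTop 0] with x hx
      have := monotoneOn_digamma (a := x + d) (b := x + N) (by simp; linarith)
        (by simp; linarith) (by linarith)
      linarith
  simpa using! hdiff.div_const d

theorem alternatingDiff_inv_mul_inv (n : ℕ) {c d : ℝ} (hc : 0 ≤ c) (hd : 0 ≤ d) :
    AlternatingDiff n fun x => (x + c)⁻¹ * (x + d)⁻¹ :=
  (AlternatingDiff.inv_add_const n hc).mul (AlternatingDiff.inv_add_const n hd)

theorem alternatingDiff_digammaSlope (n : ℕ) {d : ℝ} (hd : 0 < d) :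
    AlternatingDiff n (digammaSlope d) :=
  AlternatingDiff.of_sub_comp_add_one
    ((alternatingDiff_inv_mul_inv n le_rfl hd.le).congr fun x hx => by
      rw [digammaSlope_sub_add_one hd hx, add_zero])
    (tendsto_digammaSlope hd)

theorem tendsto_trigammaSlope {d : ℝ} (hd : 0 < d) : Tendsto (trigammaSlope d) atTop (𝓝 0) :=
  (alternatingDiff_digammaSlope 2 hd).tendsto_deriv_zero
    (fun _ hx => hasDerivAt_digammaSlope hd hx) (tendsto_digammaSlope hd)

theorem alternatingDiff_sub_two_mul_digammaSlope (n : ℕ) {d : ℝ} (hd : 1 < d) :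
    AlternatingDiff n fun x =>
      (2 * x + d + 1) * (x⁻¹ * (x + d)⁻¹) - 2 * digammaSlope d x := by
  have hd0 : 0 < d := by linarith
  refine AlternatingDiff.of_sub_comp_add_one ?_ ?_
  · have hprod : AlternatingDiff n fun x => (d ^ 2 - 1) *
        (((x + 0)⁻¹ * (x + d)⁻¹) * ((x + 1)⁻¹ * (x + (d + 1))⁻¹)) :=
      ((alternatingDiff_inv_mul_inv n le_rfl hd0.le).mul
        (alternatingDiff_inv_mul_inv n zero_le_one (by linarith))).const_mul (by nlinarith)
    refine hprod.congr fun x hx => ?_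
    have hslope := digammaSlope_sub_add_one hd0 hx
    have h1 : x ≠ 0 := by positivity
    have h2 : x + d ≠ 0 := by positivity
    have h3 : x + 1 ≠ 0 := by positivity
    have h4 : x + (d + 1) ≠ 0 := by positivity
    rw [show digammaSlope d (x + 1) = digammaSlope d x - x⁻¹ * (x + d)⁻¹ by linarith,
      show x + 1 + d = x + (d + 1) by ring, add_zero]
    field_simp
    ring
  · have hinv : Tendsto (fun x : ℝ => x⁻¹) atTop (𝓝 0) := tendsto_inv_atTop_zero
    have hinvd : Tendsto (fun x : ℝ => (x + d)⁻¹) atTop (𝓝 0) :=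
      hinv.comp (tendsto_atTop_add_const_right atTop d tendsto_id)
    have hlim := ((hinv.add hinvd).add (hinv.mul hinvd)).sub
      ((tendsto_digammaSlope hd0).const_mul 2)
    simp only [add_zero, mul_zero, sub_zero] at hlim
    refine hlim.congr' ?_
    filter_upwards [eventually_gt_atTop 0] with x hx
    have : x + d ≠ 0 := by positivity
    field_simp
    ring

theorem alternatingDiff_neg_sq_add_trigammaSlope (n : ℕ) {d : ℝ} (hd : 1 < d) :
    AlternatingDiff n fun x => -(digammaSlope d x ^ 2 + trigammaSlope d x) := by
  have hd0 : 0 < d := by linarith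
  refine AlternatingDiff.of_sub_comp_add_one ?_ ?_
  · refine ((alternatingDiff_inv_mul_inv n le_rfl hd0.le).mul
      (alternatingDiff_sub_two_mul_digammaSlope n hd)).congr fun x hx => ?_
    have hdigamma := digammaSlope_sub_add_one hd0 hx
    have htrigamma := trigammaSlope_sub_add_one hd0 hx
    rw [add_zero]
    rw [show digammaSlope d (x + 1) = digammaSlope d x - x⁻¹ * (x + d)⁻¹ by linarith]
    linear_combination htrigamma
  · simpa using (((tendsto_digammaSlope hd0).pow 2).add (tendsto_trigammaSlope hd0)).neg

theorem contDiffOn_neg_sq_add_trigammaSlope {d : ℝ} (hd : 0 < d) :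
    ContDiffOn ℝ ∞ (fun x => -(digammaSlope d x ^ 2 + trigammaSlope d x)) (Ioi 0) := by
  have hshift : MapsTo (fun x : ℝ => x + d) (Ioi 0) (Ioi 0) := fun x (hx : 0 < x) =>
    add_pos hx hd
  have hadd : ContDiffOn ℝ ∞ (fun x : ℝ => x + d) (Ioi 0) := by fun_prop
  have hdigamma : ContDiffOn ℝ ∞ (digammaSlope d) (Ioi 0) :=
    ((contDiffOn_digamma.comp hadd hshift).sub contDiffOn_digamma).div_const d
  have htrigamma : ContDiffOn ℝ ∞ (trigammaSlope d) (Ioi 0) :=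
    ((contDiffOn_trigamma.comp hadd hshift).sub contDiffOn_trigamma).div_const d
  exact ((hdigamma.pow 2).add htrigamma).neg

/-- For `|t - s| > 1`, the function `−Δ_{s,t}(x)`, where
`Δ_{s,t}(x) = [(ψ(x+t) − ψ(x+s))/(t − s)]² + (ψ'(x+t) − ψ'(x+s))/(t − s)`,
is completely monotonic on `(−min{s,t}, ∞)`. -/
theorem neg_delta_completely_monotonic (s t : ℝ) (h : |t - s| > 1) :
    ∀ n : ℕ, ∀ x ∈ Set.Ioi (-(min s t)),
      0 ≤ (-1 : ℝ) ^ n *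
        iteratedDeriv n
          (fun y : ℝ =>
            -(((digamma (y + t) - digamma (y + s)) / (t - s)) ^ 2 +
              (trigamma (y + t) - trigamma (y + s)) / (t - s))) x := by
  intro n x hx
  wlog hst : s ≤ t generalizing s t
  · have := this t s (by rwa [abs_sub_comm]) (by rwa [min_comm]) (le_of_not_ge hst)
    convert this using 4 with y
    rw [← neg_sub t s, ← neg_sub (digamma (y + t)), ← neg_sub (trigamma (y + t)), neg_div_neg_eq,
      neg_div_neg_eq]
  have hd : 1 < t - s := by rwa [abs_of_nonneg (by linarith)] at h
  rw [min_eq_left hst, mem_Ioi] at hx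
  have hnonneg := (alternatingDiff_neg_sq_add_trigammaSlope n hd).iteratedDeriv_nonneg
    (contDiffOn_neg_sq_add_trigammaSlope (by linarith)) (by linarith : 0 < x + s)
  have hshift := congrFun (iteratedDeriv_comp_add_const n
    (fun x => -(digammaSlope (t - s) x ^ 2 + trigammaSlope (t - s) x)) s) x
  rw [← hshift] at hnonneg
  simpa [digammaSlope, trigammaSlope, add_assoc] using hnonneg
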